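/- The complex-valued function f : ℝ → ℂ defined by f(η) = η + (exp(−√3·i·η) − 1)/(√3·i) satisfies the unsteady similarity equation with κ = −2, namely f'''(η) − f(η)·f''(η) − 1 + (f'(η))² = −2·(f'(η) + (η/2)·f''(η) − 1) for all real η, together with the wall boundary conditions f(0) = 0 and f'(0) = 0. -/

import Mathlib

theorem hasDerivAt_cexp_neg_mul_ofReal (c : ℂ) (x : ℝ) :
    HasDerivAt (fun η : ℝ => Complex.exp (-(c * (η : ℂ))))
      (-c * Complex.exp (-(c * (x : ℂ)))) x := by
  have h : HasDerivAt (fun η : ℝ => -(c * (η : ℂ))) (-c) x := by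
    simpa using ((hasDerivAt_id x).ofReal_comp.const_mul c).fun_neg
  simpa [mul_comm] using h.cexp

/-- `f(η) = η + (e^{-√3·i·η} - 1)/(√3·i)` satisfies the unsteady similarity equation
with `κ = -2` together with the wall boundary conditions `f(0) = 0`, `f'(0) = 0`. -/
theorem stmt_11 (f : ℝ → ℂ)
    (hf : f = fun η : ℝ => (η : ℂ) +
      (Complex.exp (-((Real.sqrt 3 : ℂ) * Complex.I * (η : ℂ))) - 1)
        / ((Real.sqrt 3 : ℂ) * Complex.I)) :
    (∀ η : ℝ,
      iteratedDeriv 3 f η - f η * iteratedDeriv 2 f η - 1 + (deriv f η) ^ 2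
        = -2 * (deriv f η + (η : ℂ) / 2 * iteratedDeriv 2 f η - 1)) ∧
    f 0 = 0 ∧ deriv f 0 = 0 := by
  have hc2 : ((Real.sqrt 3 : ℂ) * Complex.I) ^ 2 = -3 := by
    rw [mul_pow, Complex.I_sq, ← Complex.ofReal_pow, Real.sq_sqrt (by norm_num)]
    norm_num
  generalize (Real.sqrt 3 : ℂ) * Complex.I = c at hf hc2
  have hc : c ≠ 0 := by
    rintro rfl
    norm_num at hc2
  have h1 : deriv f = fun η : ℝ => 1 - Complex.exp (-(c * (η : ℂ))) := by
    funext x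
    rw [hf]
    refine ((hasDerivAt_id x).ofReal_comp.fun_add
      (((hasDerivAt_cexp_neg_mul_ofReal c x).sub_const 1).div_const c)).deriv.trans ?_
    rw [Complex.ofReal_one]
    field_simp
    ring
  have h2 : iteratedDeriv 2 f = fun η : ℝ => c * Complex.exp (-(c * (η : ℂ))) := by
    rw [iteratedDeriv_succ, iteratedDeriv_one, h1]
    funext x
    rw [((hasDerivAt_cexp_neg_mul_ofReal c x).const_sub 1).deriv]
    ring
  have h3 : iteratedDeriv 3 f = fun η : ℝ => 3 * Complex.exp (-(c * (η : ℂ))) := by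
    rw [iteratedDeriv_succ, h2]
    funext x
    rw [((hasDerivAt_cexp_neg_mul_ofReal c x).const_mul c).deriv]
    linear_combination -Complex.exp (-(c * (x : ℂ))) * hc2
  refine ⟨fun η => ?_, ?_, ?_⟩
  · rw [h1, h2, h3, hf]
    field_simp
    ring
  · simp [hf]
  · simp [h1]
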